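/- Let Ω be a finite nonempty set and (Ω,Λ) a game satisfying Assumptions 1 and 2, and let c ≥ 1 and η > 0 be reals. Then the following are equivalent: (i) the Aggregating Algorithm is (c,η)-realizable for (Ω,Λ), i.e. for every k ≥ 1, all g_1,…,g_k ∈ Σ_Λ and all reals ρ_i ≥ 0 with ∑_i ρ_i = 1 there exists γ ∈ Σ_Λ such that exp(η·γ(ω)/c)·∑_{i=1}^k ρ_i·exp(−η·g_i(ω)) ≤ 1 for all ω ∈ Ω; (ii) there exists a map λ : 𝒫°(Ω) → Σ_Λ such that for every g ∈ Σ_Λ the function q_g(π,ω) := exp(η·λ(π)(ω)/c)·exp(−η·g(ω)) satisfies: π ↦ q_g(π,ω) is continuous on 𝒫°(Ω) for each ω ∈ Ω, and E_π q_g(π,·) ≤ 1 for all π ∈ 𝒫°(Ω). -/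

import Mathlib

open scoped ENNReal BigOperators
open Filter

noncomputable section

variable {Ω : Type*} [Fintype Ω]

/-- `pexp r t = exp(r·t)` for `t ∈ [0,∞]`, with value `∞` when `t = ∞`. -/
def pexp (r : ℝ) (t : ℝ≥0∞) : ℝ≥0∞ :=
  if t = ∞ then ∞ else ENNReal.ofReal (Real.exp (r * t.toReal))

/-- `nexp r t = exp(−r·t)` for `t ∈ [0,∞]`, with value `0` when `t = ∞`. -/
def nexp (r : ℝ) (t : ℝ≥0∞) : ℝ≥0∞ :=
  if t = ∞ then 0 else ENNReal.ofReal (Real.exp (-(r * t.toReal)))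

/-- Expectation `E_π g = ∑_{ω : π ω ≠ 0} π(ω)·g(ω)` in `[0,∞]` (since `0·∞ = 0` in
`ℝ≥0∞`, the terms with `π ω = 0` contribute nothing, so we may sum over all `ω`). -/
def expect (π : Ω → ℝ) (g : Ω → ℝ≥0∞) : ℝ≥0∞ :=
  ∑ ω, ENNReal.ofReal (π ω) * g ω

/-- The superprediction set `Σ_Λ` of a game `(Ω, Λ)`. -/
def superpred (Λ : Set (Ω → ℝ≥0∞)) : Set (Ω → ℝ≥0∞) :=
  {g | ∃ γ ∈ Λ, ∀ ω, γ ω ≤ g ω}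

/-- `−(1/η)·ln x`, with value `∞` at `x = 0`. -/
def negLogDiv (η : ℝ) (x : ℝ≥0∞) : ℝ≥0∞ :=
  if x = 0 then ∞ else ENNReal.ofReal (-(1 / η) * Real.log x.toReal)

/-- The exp-convex hull `Σ_Λ^η` of the superprediction set. -/
def expHull (η : ℝ) (Λ : Set (Ω → ℝ≥0∞)) : Set (Ω → ℝ≥0∞) :=
  {g | ∃ k : ℕ, 0 < k ∧ ∃ (gs : Fin k → Ω → ℝ≥0∞) (ρ : Fin k → ℝ),
    (∀ i, gs i ∈ superpred Λ) ∧ (∀ i, 0 ≤ ρ i) ∧ (∑ i, ρ i = 1) ∧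
    ∀ ω, g ω = negLogDiv η (∑ i, ENNReal.ofReal (ρ i) * nexp η (gs i ω))}

/-- The set of minimal elements of `X`. -/
def minSet (X : Set (Ω → ℝ≥0∞)) : Set (Ω → ℝ≥0∞) :=
  {g | g ∈ X ∧ ∀ g' ∈ X, (∀ ω, g' ω ≤ g ω) → g' = g}

/-- A finite set `S` is dominant for a family of orders (given by the rank functions `r i`) if
no point lies strictly above the minimum of `S` in all of the orders at once. -/
def IsDominant {V I L : Type*} [LinearOrder L] (r : I → V → L) (S : Finset V) : Prop :=
  ∀ y, ∃ i, ∀ x ∈ S, r i y ≤ r i x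

/-- A surjection from a finite type onto a set with one element fewer identifies exactly one
pair of points. -/
theorem exists_unique_collision {V I : Type*} [DecidableEq V] [Fintype I] [DecidableEq I]
    {τ : Finset V} {m : I → V} (hcard : τ.card + 1 = Fintype.card I) (hm : ∀ i, m i ∈ τ)
    (hsurj : ∀ z ∈ τ, ∃ i, m i = z) :
    ∃ i j, i ≠ j ∧ m i = m j ∧ ∀ p q, p ≠ q → m p = m q → p = i ∨ p = j := by
  obtain ⟨i, -, j, -, hij, hmij⟩ := Finset.exists_ne_map_eq_of_card_lt_of_maps_to
    (s := (Finset.univ : Finset I)) (t := τ) (f := m)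
    (by rw [Finset.card_univ]; omega) (fun i _ => hm i)
  refine ⟨i, j, hij, hmij, fun p q hpq hmpq => ?_⟩
  by_contra! hp
  have hsub : τ ⊆ ((Finset.univ.erase p).erase i).image m := by
    intro z hz
    obtain ⟨l, rfl⟩ := hsurj z hz
    simp only [Finset.mem_image, Finset.mem_erase, Finset.mem_univ, and_true]
    by_cases hli : l = i
    · exact ⟨j, ⟨hij.symm, hp.2.symm⟩, by rw [hli, hmij]⟩
    · by_cases hlp : l = p
      · by_cases hqi : q = i
        · exact ⟨j, ⟨hij.symm, hp.2.symm⟩, by rw [hlp, hmpq, hqi, hmij]⟩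
        · exact ⟨q, ⟨hqi, hpq.symm⟩, by rw [hlp, hmpq]⟩
      · exact ⟨l, ⟨hli, hlp⟩, rfl⟩
  have h1 := (Finset.card_le_card hsub).trans Finset.card_image_le
  have h2 : ((Finset.univ.erase p).erase i).card = Fintype.card I - 1 - 1 := by
    rw [Finset.card_erase_of_mem (by simp [hp.1.symm]), Finset.card_erase_of_mem (by simp),
      Finset.card_univ]
  have h3 : 1 < Fintype.card I := Fintype.one_lt_card_iff.2 ⟨i, j, hij⟩
  omega

open Classical in
/-- If a set of full size does not carry all colours, an even number of its facets carry exactly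
the colours other than `i₀`. -/
theorem even_card_facets {V I : Type*} [DecidableEq V] [Fintype I] [DecidableEq I]
    (c : V → I) (i₀ : I) {S : Finset V} (hcard : S.card = Fintype.card I)
    (hS : S.image c ≠ Finset.univ) :
    Even (S.filter fun x => (S.erase x).image c = Finset.univ.erase i₀).card := by
  by_cases hE : ∃ x ∈ S, (S.erase x).image c = Finset.univ.erase i₀
  swap
  · push Not at hE
    rw [Finset.filter_eq_empty_iff.2 fun {x} hx => hE x hx]
    simp
  obtain ⟨x, hxS, hx⟩ := hE
  have hins : ∀ z ∈ S, S.image c = insert (c z) ((S.erase z).image c) := fun z hz => by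
    rw [← Finset.image_insert, Finset.insert_erase hz]
  have hcx : c x ≠ i₀ := by
    intro h
    apply hS
    rw [hins x hxS, hx, h, Finset.insert_erase (Finset.mem_univ _)]
  have hcx' : c x ∈ (S.erase x).image c := by
    rw [hx]; exact Finset.mem_erase.2 ⟨hcx, Finset.mem_univ _⟩
  obtain ⟨x', hx', hcc⟩ := Finset.mem_image.1 hcx'
  obtain ⟨hne, hx'S⟩ := Finset.mem_erase.1 hx'
  have hx2 : (S.erase x').image c = Finset.univ.erase i₀ := by
    have h1 := hins x hxS
    have h2 := hins x' hx'S
    rw [Finset.insert_eq_of_mem hcx'] at h1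
    rw [Finset.insert_eq_of_mem (hcc ▸ Finset.mem_image_of_mem c
      (Finset.mem_erase.2 ⟨hne.symm, hxS⟩))] at h2
    rw [← h2, h1, hx]
  have hset : (S.filter fun x => (S.erase x).image c = Finset.univ.erase i₀) = {x, x'} := by
    ext z
    simp only [Finset.mem_filter, Finset.mem_insert, Finset.mem_singleton]
    constructor
    · rintro ⟨hzS, hz⟩
      by_contra! hzx
      have hinj : Set.InjOn c (S.erase z) := by
        rw [← Finset.card_image_iff, hz, Finset.card_erase_of_mem (Finset.mem_univ _),
          Finset.card_erase_of_mem hzS, hcard, Finset.card_univ]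
      exact hne (hinj (by simp [hx'S, hzx.2.symm]) (by simp [hxS, hzx.1.symm]) hcc)
    · rintro (rfl | rfl)
      · exact ⟨hxS, hx⟩
      · exact ⟨hx'S, hx2⟩
  rw [hset, Finset.card_pair hne.symm]
  exact even_two

section Scarf

variable {V I L : Type*} [Fintype V] [DecidableEq V] [Fintype I] [DecidableEq I] [LinearOrder L]
  {r : I → V → L}

open Classical in
/-- A set one element short of full size, and not consisting of slack points only, has an even
number of dominant one-point extensions. -/
theorem even_card_dominant_insert (hr : ∀ i, Function.Injective (r i)) {s : I → V}
    (hs : ∀ i l y, y ∉ Set.range s → l ≠ i → r l y < r l (s i))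
    {τ : Finset V} (hcard : τ.card + 1 = Fintype.card I) {t : V} (ht : t ∈ τ)
    (hts : t ∉ Set.range s) :
    Even (Finset.univ.filter fun x => x ∉ τ ∧ IsDominant r (insert x τ)).card := by
  by_cases hτ : IsDominant r τ
  swap
  · rw [Finset.filter_eq_empty_iff.2]
    · simp
    · rintro x - ⟨-, hx⟩
      exact hτ fun y => (hx y).imp fun i hi z hz => hi z (Finset.mem_insert_of_mem hz)
  have hmin : ∀ i, ∃ z ∈ τ, ∀ x ∈ τ, r i z ≤ r i x := fun i =>
    Finset.exists_min_image τ (r i) ⟨t, ht⟩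
  choose m hmτ hmle using hmin
  have hmeq : ∀ i, ∀ z ∈ τ, (∀ x ∈ τ, r i z ≤ r i x) → m i = z := fun i z hz h =>
    hr i (le_antisymm (hmle i z hz) (h _ (hmτ i)))
  obtain ⟨i, j, hij, hmij, huniq⟩ := exists_unique_collision hcard hmτ
    fun z hz => (hτ z).imp fun i hi => hmeq i z hz hi
  have hbest : ∀ k, ∃ x, (∀ l, l ≠ k → r l (m l) < r l x) ∧
      ∀ y, (∀ l, l ≠ k → r l (m l) < r l y) → r k y ≤ r k x := by
    intro k
    obtain ⟨x, hx, hx'⟩ := Finset.exists_max_image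
      (Finset.univ.filter fun x => ∀ l, l ≠ k → r l (m l) < r l x) (r k)
      ⟨s k, by
        simp only [Finset.mem_filter, Finset.mem_univ, true_and]
        exact fun l hl => (hmle l t ht).trans_lt (hs k l t hts hl)⟩
    simp only [Finset.mem_filter, Finset.mem_univ, true_and] at hx hx'
    exact ⟨x, hx, hx'⟩
  choose b hb hbmax using hbest
  have hgood : ∀ k l, k ≠ l → m k = m l → b k ∉ τ ∧ IsDominant r (insert (b k) τ) := by
    intro k l hkl hmkl
    constructor
    · intro hk
      obtain ⟨p, hp⟩ := hτ (b k)
      have hp' := hmeq p _ hk hp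
      by_cases hpk : p = k
      · subst hpk
        have := hb p l hkl.symm
        rw [← hmkl, hp'] at this
        exact lt_irrefl _ this
      · have := hb k p hpk
        rw [hp'] at this
        exact lt_irrefl _ this
    · intro y
      by_cases hy : ∀ p, p ≠ k → r p (m p) < r p y
      · refine ⟨k, fun x hx => ?_⟩
        rcases Finset.mem_insert.1 hx with rfl | hx
        · exact hbmax k y hy
        · obtain ⟨p, hp⟩ := hτ y
          have hpk : p = k := by
            by_contra hpk
            exact (hy p hpk).not_ge (hp _ (hmτ p))
          exact hpk ▸ hp x hx
      · push Not at hy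
        obtain ⟨p, hpk, hp⟩ := hy
        refine ⟨p, fun x hx => ?_⟩
        rcases Finset.mem_insert.1 hx with rfl | hx
        · exact hp.trans (hb k p hpk).le
        · exact hp.trans (hmle p x hx)
  have hne : b i ≠ b j := by
    intro hbij
    obtain ⟨p, hp⟩ := hτ (b i)
    have hpm := hp _ (hmτ p)
    by_cases hpi : p = i
    · rw [hbij] at hpm
      exact (hb j p (hpi ▸ hij)).not_ge hpm
    · exact (hb i p hpi).not_ge hpm
  have hset : (Finset.univ.filter fun x => x ∉ τ ∧ IsDominant r (insert x τ)) = {b i, b j} := by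
    ext x
    simp only [Finset.mem_filter, Finset.mem_univ, true_and, Finset.mem_insert,
      Finset.mem_singleton]
    constructor
    · rintro ⟨hxτ, hx⟩
      obtain ⟨k, hk⟩ := hx x
      have hxk : ∀ l, r l x ≤ r l (m l) → ∀ z ∈ τ, ¬ ∀ y ∈ insert x τ, r l z ≤ r l y := by
        intro l hl z hz h
        have h1 := hmeq l z hz fun y hy => h y (Finset.mem_insert_of_mem hy)
        have h2 := h x (Finset.mem_insert_self _ _)
        rw [h1] at hl
        exact hxτ (hr l (le_antisymm hl h2) ▸ hz)
      have hkm : r k x ≤ r k (m k) := hk _ (Finset.mem_insert_of_mem (hmτ k))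
      have hkij : k = i ∨ k = j := by
        obtain ⟨p, hp⟩ := hx (m k)
        have hpk : k ≠ p := by
          rintro rfl
          exact hxk k hkm _ (hmτ k) hp
        exact huniq k p hpk
          (hmeq p _ (hmτ k) fun y hy => hp y (Finset.mem_insert_of_mem hy)).symm
      have hxM : ∀ l, l ≠ k → r l (m l) < r l x := by
        intro l hlk
        by_contra! hl
        have hsub : τ ⊆ ((Finset.univ.erase k).erase l).image m := by
          intro z hz
          obtain ⟨p, hp⟩ := hx z
          refine Finset.mem_image.2 ⟨p, ?_,
            hmeq p z hz fun y hy => hp y (Finset.mem_insert_of_mem hy)⟩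
          simp only [Finset.mem_erase, Finset.mem_univ, and_true]
          constructor
          · rintro rfl
            exact hxk p hl z hz hp
          · rintro rfl
            exact hxk p hkm z hz hp
        have h1 := (Finset.card_le_card hsub).trans Finset.card_image_le
        have h2 : ((Finset.univ.erase k).erase l).card = Fintype.card I - 1 - 1 := by
          rw [Finset.card_erase_of_mem (by simp [hlk]), Finset.card_erase_of_mem (by simp),
            Finset.card_univ]
        have h3 : 1 < Fintype.card I := Fintype.one_lt_card_iff.2 ⟨i, j, hij⟩
        omega
      have hxb : x = b k := by
        refine hr k (le_antisymm (hbmax k x hxM) ?_)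
        obtain ⟨l, hl⟩ := hx (b k)
        by_cases hlk : l = k
        · exact hlk ▸ hl x (Finset.mem_insert_self _ _)
        · exact absurd (hl _ (Finset.mem_insert_of_mem (hmτ l))) (hb k l hlk).not_ge
      rcases hkij with rfl | rfl
      · exact Or.inl hxb
      · exact Or.inr hxb
    · rintro (rfl | rfl)
      · exact hgood i j hij hmij
      · exact hgood j i hij.symm hmij.symm
  rw [hset, Finset.card_pair hne]
  exact even_two

/-- The facet spanned by the slack points other than `s i₀` has exactly one dominant one-point
extension. -/
theorem existsUnique_dominant_insert_slack (hr : ∀ i, Function.Injective (r i)) {s : I → V}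
    (hmin : ∀ i y, r i (s i) ≤ r i y)
    (hs : ∀ i l y, y ∉ Set.range s → l ≠ i → r l y < r l (s i))
    {t : V} (ht : t ∉ Set.range s) (i₀ : I) :
    ∃! x, x ∉ (Finset.univ.erase i₀).image s ∧
      IsDominant r (insert x ((Finset.univ.erase i₀).image s)) := by
  classical
  obtain ⟨x, hx, hxmax⟩ := Finset.exists_max_image
    (Finset.univ.filter fun x => x ∉ Set.range s) (r i₀) ⟨t, by simpa using ht⟩
  simp only [Finset.mem_filter, Finset.mem_univ, true_and] at hx hxmax
  refine ⟨x, ⟨fun h => ?_, fun y => ?_⟩, ?_⟩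
  · obtain ⟨l, -, rfl⟩ := Finset.mem_image.1 h
    exact hx ⟨l, rfl⟩
  · by_cases hy : y ∈ Set.range s
    · obtain ⟨l, rfl⟩ := hy
      exact ⟨l, fun z _ => hmin l z⟩
    · refine ⟨i₀, fun z hz => ?_⟩
      rcases Finset.mem_insert.1 hz with rfl | hz
      · exact hxmax y hy
      · obtain ⟨l, hl, rfl⟩ := Finset.mem_image.1 hz
        exact (hs l i₀ y hy (Finset.ne_of_mem_erase hl).symm).le
  · rintro z ⟨hz, hzdom⟩
    have hnot : ∀ y, y ∉ Set.range s → r i₀ y ≤ r i₀ z := by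
      intro y hy
      obtain ⟨l, hl⟩ := hzdom y
      by_cases hli : l = i₀
      · exact hli ▸ hl z (Finset.mem_insert_self _ _)
      · have h1 := hl (s l) (Finset.mem_insert_of_mem
          (Finset.mem_image_of_mem s (Finset.mem_erase.2 ⟨hli, Finset.mem_univ l⟩)))
        exact absurd ⟨l, (hr l (le_antisymm h1 (hmin l y))).symm⟩ hy
    have hzs : z ∉ Set.range s := by
      rintro ⟨l, rfl⟩
      by_cases hli : l = i₀
      · subst hli
        exact ht ⟨l, hr l (le_antisymm (hmin l t) (hnot t ht))⟩
      · exact hz (Finset.mem_image_of_mem s (Finset.mem_erase.2 ⟨hli, Finset.mem_univ l⟩))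
    exact hr i₀ (le_antisymm (hxmax z hzs) (hnot x hx))

/-- **Scarf's lemma**: for a colouring giving the slack point `s i` the colour `i`, there is a
dominant set carrying all the colours. -/
theorem exists_dominant_colorful [Nonempty I] (hr : ∀ i, Function.Injective (r i)) {s : I → V}
    (hmin : ∀ i y, r i (s i) ≤ r i y)
    (hs : ∀ i l y, y ∉ Set.range s → l ≠ i → r l y < r l (s i))
    (hne : ∃ t, t ∉ Set.range s) (c : V → I) (hc : ∀ i, c (s i) = i) :
    ∃ S : Finset V, S.card = Fintype.card I ∧ IsDominant r S ∧ S.image c = Finset.univ := by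
  classical
  by_contra! hno
  obtain ⟨i₀⟩ := ‹Nonempty I›
  obtain ⟨t₀, ht₀⟩ := hne
  have hsinj : Function.Injective s := fun i j h => by rw [← hc i, h, hc]
  have hpos : 0 < Fintype.card I := Fintype.card_pos_iff.2 ⟨i₀⟩
  set R := Finset.univ.filter fun S : Finset V => S.card = Fintype.card I ∧ IsDominant r S
    with hR
  set D := Finset.univ.filter fun τ : Finset V =>
    τ.card + 1 = Fintype.card I ∧ τ.image c = Finset.univ.erase i₀ with hD
  have hcount := Finset.sum_card_bipartiteAbove_eq_sum_card_bipartiteBelow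
    (s := D) (t := R) (fun τ S => τ ⊆ S)
  have hroom : ∀ S ∈ R, Even (Finset.bipartiteBelow (fun τ S => τ ⊆ S) D S).card := by
    intro S hSR
    simp only [hR, Finset.mem_filter, Finset.mem_univ, true_and] at hSR
    have := even_card_facets c i₀ hSR.1 (hno S hSR.1 hSR.2)
    convert this using 1
    symm
    refine Finset.card_bij (fun x _ => S.erase x) ?_ ?_ ?_
    · intro x hx
      simp only [Finset.mem_filter] at hx
      simp only [Finset.bipartiteBelow, hD, Finset.mem_filter, Finset.mem_univ, true_and]
      exact ⟨⟨by rw [Finset.card_erase_of_mem hx.1]; omega, hx.2⟩, Finset.erase_subset _ _⟩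
    · intro x hx y hy h
      simp only [Finset.mem_filter] at hx hy
      exact Finset.erase_injOn S hx.1 hy.1 h
    · intro τ hτ
      simp only [Finset.bipartiteBelow, hD, Finset.mem_filter, Finset.mem_univ, true_and] at hτ
      obtain ⟨⟨h1, h2⟩, h3⟩ := hτ
      obtain ⟨x, hx, rfl⟩ := (Finset.covBy_iff_exists_insert (s := τ) (t := S)).1
        (Finset.covBy_iff_card_sdiff_eq_one.2 ⟨h3, by
          rw [Finset.card_sdiff_of_subset h3]; omega⟩)
      have h4 : (insert x τ).erase x = τ := Finset.erase_insert hx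
      exact ⟨x, by simp [h4, h2], h4⟩
  have hcard : ∀ τ ∈ D, (Finset.bipartiteAbove (fun τ S => τ ⊆ S) R τ).card =
      (Finset.univ.filter fun x => x ∉ τ ∧ IsDominant r (insert x τ)).card := by
    intro τ hτ
    simp only [hD, Finset.mem_filter, Finset.mem_univ, true_and] at hτ
    symm
    refine Finset.card_bij (fun x _ => insert x τ) ?_ ?_ ?_
    · intro x hx
      simp only [Finset.mem_filter, Finset.mem_univ, true_and] at hx
      simp only [Finset.bipartiteAbove, hR, Finset.mem_filter, Finset.mem_univ, true_and]
      exact ⟨⟨by rw [Finset.card_insert_of_notMem hx.1]; omega, hx.2⟩,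
        Finset.subset_insert _ _⟩
    · intro x hx y hy h
      simp only [Finset.mem_filter, Finset.mem_univ, true_and] at hx hy
      exact (Finset.insert_inj hx.1).1 h
    · intro S hS
      simp only [Finset.bipartiteAbove, hR, Finset.mem_filter, Finset.mem_univ, true_and] at hS
      obtain ⟨⟨h1, h2⟩, h3⟩ := hS
      obtain ⟨x, hx, rfl⟩ := (Finset.covBy_iff_exists_insert (s := τ) (t := S)).1
        (Finset.covBy_iff_card_sdiff_eq_one.2 ⟨h3, by
          rw [Finset.card_sdiff_of_subset h3]; omega⟩)
      exact ⟨x, by simp [hx, h2], rfl⟩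
  set E := (Finset.univ.erase i₀).image s with hE
  have hEcard : E.card + 1 = Fintype.card I := by
    rw [hE, Finset.card_image_of_injective _ hsinj, Finset.card_erase_of_mem (Finset.mem_univ _),
      Finset.card_univ]
    omega
  have hED : E ∈ D := by
    simp only [hD, Finset.mem_filter, Finset.mem_univ, true_and]
    refine ⟨hEcard, ?_⟩
    rw [hE, Finset.image_image, show c ∘ s = id from funext hc, Finset.image_id]
  have hEone : (Finset.bipartiteAbove (fun τ S => τ ⊆ S) R E).card = 1 := by
    rw [hcard E hED, Finset.card_eq_one]
    obtain ⟨x, hx, hx'⟩ := existsUnique_dominant_insert_slack hr hmin hs ht₀ i₀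
    refine ⟨x, ?_⟩
    ext z
    simp only [Finset.mem_filter, Finset.mem_univ, true_and, Finset.mem_singleton]
    exact ⟨hx' z, fun h => h ▸ hx⟩
  have hother : ∀ τ ∈ D.erase E, Even (Finset.bipartiteAbove (fun τ S => τ ⊆ S) R τ).card := by
    intro τ hτ
    obtain ⟨hτE, hτD⟩ := Finset.mem_erase.1 hτ
    rw [hcard τ hτD]
    simp only [hD, Finset.mem_filter, Finset.mem_univ, true_and] at hτD
    have hT : ∃ t ∈ τ, t ∉ Set.range s := by
      by_contra! hall
      apply hτE
      refine Finset.eq_of_subset_of_card_le (fun z hz => ?_) (by omega)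
      obtain ⟨l, rfl⟩ := hall z hz
      have : c (s l) ∈ τ.image c := Finset.mem_image_of_mem c hz
      rw [hτD.2, hc] at this
      exact Finset.mem_image_of_mem s this
    obtain ⟨t, ht, hts⟩ := hT
    exact even_card_dominant_insert hr hs hτD.1 ht hts
  rw [← Finset.add_sum_erase D _ hED, hEone] at hcount
  have h1 := Finset.even_sum _ hroom
  have h2 := Finset.even_sum _ hother
  rw [← hcount, add_comm, Nat.even_add_one] at h1
  exact h1 h2

end Scarf

/-- The point of `ℤ^I` representing a grid point of the simplex, or a slack point lying below
the `i`-th facet. -/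
def gridVal {I : Type*} [DecidableEq I] {T : Type*} (N : ℕ) (v : T → I → ℕ) : T ⊕ I → I → ℤ
  | Sum.inl a, l => v a l
  | Sum.inr i, l => if l = i then -1 else N + 1

/-- For any colouring of the grid points of a simplex there is a grid point which, for each
colour `i`, has small `i`-th coordinate or is close to a grid point of colour `i`. -/
theorem exists_grid_point_near_colors {I : Type*} [Fintype I] [Nonempty I]
    (N : ℕ) (c : (I → ℕ) → I) :
    ∃ x : I → ℕ, ∑ i, x i = N ∧ ∀ i, x i ≤ Fintype.card I ∨ ∃ y : I → ℕ, ∑ i, y i = N ∧ c y = i ∧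
      ∀ l, y l ≤ x l + Fintype.card I ∧ x l ≤ y l + Fintype.card I := by
  classical
  let T := {a : I → ℕ // a ∈ Finset.piAntidiag Finset.univ N}
  let _ : Fintype T := Finset.Subtype.fintype _
  have hT : ∀ a : T, ∑ i, a.1 i = N := fun a => (Finset.mem_piAntidiag.1 a.2).1
  let val : T ⊕ I → I → ℤ := gridVal N (fun a : T => a.1)
  let r : I → T ⊕ I → ℤ ×ₗ Fin (Fintype.card (T ⊕ I)) := fun i v =>
    toLex (val v i, Fintype.equivFin _ v)
  have hr : ∀ i, Function.Injective (r i) := fun i v w h =>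
    (Fintype.equivFin (T ⊕ I)).injective (congrArg (fun p => (ofLex p).2) h)
  have hle : ∀ i v w, r i v ≤ r i w → val v i ≤ val w i := by
    intro i v w h
    rcases Prod.Lex.le_iff.1 h with h | h
    · exact h.le
    · exact h.1.le
  have hlt : ∀ i v w, val v i < val w i → r i v < r i w := fun i v w h =>
    Prod.Lex.lt_iff.2 (Or.inl h)
  have hT_le : ∀ (a : T) i, a.1 i ≤ N := fun a i =>
    (Finset.single_le_sum (f := a.1) (fun _ _ => Nat.zero_le _) (Finset.mem_univ i)).trans
      (hT a).le
  have hmin : ∀ i y, r i (Sum.inr i) ≤ r i y := by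
    intro i y
    rcases y with a | j
    · exact (hlt _ _ _ (by simp only [val, gridVal, if_true]; omega)).le
    · by_cases hij : i = j
      · rw [hij]
      · exact (hlt _ _ _ (by simp only [val, gridVal, if_true, if_neg hij]; omega)).le
  have hs : ∀ i l (y : T ⊕ I), y ∉ Set.range (Sum.inr : I → T ⊕ I) → l ≠ i →
      r l y < r l (Sum.inr i) := by
    intro i l y hy hl
    rcases y with a | j
    · have := hT_le a l
      exact hlt _ _ _ (by simp only [val, gridVal, if_neg hl]; omega)
    · exact absurd ⟨j, rfl⟩ hy
  obtain ⟨i₀⟩ := ‹Nonempty I›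
  have hne : ∃ t : T ⊕ I, t ∉ Set.range (Sum.inr : I → T ⊕ I) :=
    ⟨Sum.inl ⟨Pi.single i₀ N, by simp [Finset.mem_piAntidiag]⟩, by simp⟩
  obtain ⟨S, hcard, hdom, hcol⟩ := exists_dominant_colorful hr hmin hs hne
    (Sum.elim (fun a => c a.1) id) (fun i => rfl)
  have hSne : S.Nonempty := by
    rw [← Finset.card_pos, hcard]
    exact Fintype.card_pos_iff.2 ⟨i₀⟩
  choose a haS ha using fun i => Finset.exists_min_image S (fun v => val v i) hSne
  have hlow : ∀ i, -1 ≤ val (a i) i := by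
    intro i
    rcases a i with b | j
    · simp only [val, gridVal]; omega
    · simp only [val, gridVal]; split_ifs <;> omega
  have hsum : (N : ℤ) + 1 ≤ ∑ i, (val (a i) i + 1) := by
    by_contra! hlt'
    have hz : ((∑ i, (val (a i) i + 1).toNat : ℕ) : ℤ) = ∑ i, (val (a i) i + 1) := by
      rw [Nat.cast_sum]
      exact Finset.sum_congr rfl fun i _ => Int.toNat_of_nonneg (by linarith [hlow i])
    set Z := ∑ i, (val (a i) i + 1).toNat with hZ
    let y : I → ℕ := fun i => (val (a i) i + 1).toNat + if i = i₀ then N - Z else 0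
    have hy : ∑ i, y i = N := by
      simp only [y, Finset.sum_add_distrib, Finset.sum_ite_eq', Finset.mem_univ, if_true]
      omega
    obtain ⟨i, hi⟩ := hdom (Sum.inl ⟨y, by simp [Finset.mem_piAntidiag, hy]⟩)
    have h1 := hle _ _ _ (hi (a i) (haS i))
    have h2 : val (a i) i + 1 ≤ (y i : ℤ) := by
      simp only [y]
      push_cast
      have := Int.self_le_toNat (val (a i) i + 1)
      split_ifs <;> omega
    change (y i : ℤ) ≤ _ at h1
    omega
  have hnear : ∀ x : T, Sum.inl x ∈ S →
      ∀ i, val (a i) i ≤ x.1 i ∧ (x.1 i : ℤ) + 1 ≤ val (a i) i + Fintype.card I := by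
    intro x hx i
    have h0 : ∀ i, 0 ≤ (x.1 i : ℤ) - val (a i) i := fun i => sub_nonneg.2 (ha i _ hx)
    have h1 := Finset.single_le_sum (fun i _ => h0 i) (Finset.mem_univ i)
    rw [Finset.sum_sub_distrib] at h1
    rw [Finset.sum_add_distrib] at hsum
    simp only [Finset.sum_const, Finset.card_univ, nsmul_eq_mul, mul_one] at hsum
    have h2 : ∑ i, (x.1 i : ℤ) = N := by exact_mod_cast hT x
    have := h0 i
    constructor <;> omega
  obtain ⟨x, hx⟩ : ∃ x : T, Sum.inl x ∈ S := by
    by_contra! hno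
    have : ∀ i, val (a i) i = -1 := by
      intro i
      have hmem : Sum.inr i ∈ S := by
        obtain ⟨v, hv, hvi⟩ := Finset.mem_image.1 (hcol ▸ Finset.mem_univ i)
        rcases v with b | j
        · exact absurd hv (hno b)
        · exact (show j = i from hvi) ▸ hv
      refine le_antisymm ((ha i _ hmem).trans ?_) (hlow i)
      simp [val, gridVal]
    simp only [this, neg_add_cancel, Finset.sum_const_zero] at hsum
    omega
  refine ⟨x.1, hT x, fun i => ?_⟩
  obtain ⟨v, hv, hvi⟩ := Finset.mem_image.1 (hcol ▸ Finset.mem_univ i)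
  rcases v with y | j
  · refine Or.inr ⟨y.1, hT y, hvi, fun l => ?_⟩
    have h1 := hnear x hx l
    have h2 := hnear y hv l
    constructor <;> omega
  · refine Or.inl ?_
    have hji : j = i := hvi
    subst hji
    have h1 := hnear x hx j
    have h2 := ha j _ hv
    simp only [val, gridVal, if_true] at h1 h2
    omega

/-- A fixed-point theorem on the simplex: a nonnegative continuous `h` is proportional to `μ` at
some point `μ` of the simplex. -/
theorem exists_mem_stdSimplex_proportional {I : Type*} [Fintype I] [Nonempty I]
    {h : (I → ℝ) → I → ℝ} (hcont : ∀ i, ContinuousOn (fun μ => h μ i) (stdSimplex ℝ I))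
    (hnn : ∀ μ ∈ stdSimplex ℝ I, ∀ i, 0 ≤ h μ i) :
    ∃ μ ∈ stdSimplex ℝ I, ∀ i, h μ i = μ i * ∑ j, h μ j := by
  classical
  suffices ∃ μ ∈ stdSimplex ℝ I, ∀ i, μ i * ∑ j, h μ j ≤ h μ i by
    obtain ⟨μ, hμ, hle⟩ := this
    refine ⟨μ, hμ, fun i => ?_⟩
    have hs : ∑ i, μ i * ∑ j, h μ j = ∑ i, h μ i := by
      rw [← Finset.sum_mul, hμ.2, one_mul]
    exact ((Finset.sum_eq_sum_iff_of_le fun i _ => hle i).1 hs i (Finset.mem_univ i)).symm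
  have hlabel : ∀ μ ∈ stdSimplex ℝ I, ∃ i, μ i * ∑ j, h μ j ≤ h μ i := by
    intro μ hμ
    by_contra! hlt
    have := Finset.sum_lt_sum_of_nonempty Finset.univ_nonempty fun i _ => hlt i
    rw [← Finset.sum_mul, hμ.2, one_mul] at this
    exact lt_irrefl _ this
  let pt : ℕ → (I → ℕ) → I → ℝ := fun N a i => (a i : ℝ) / (N + 1 : ℕ)
  have hpt : ∀ N (a : I → ℕ), ∑ i, a i = N + 1 → pt N a ∈ stdSimplex ℝ I := by
    intro N a ha
    refine ⟨fun i => by positivity, ?_⟩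
    simp only [pt]
    rw [← Finset.sum_div, ← Nat.cast_sum, ha]
    exact div_self (by positivity)
  have hcol : ∀ N, ∃ c : (I → ℕ) → I, ∀ a, ∑ i, a i = N + 1 →
      pt N a (c a) * ∑ j, h (pt N a) j ≤ h (pt N a) (c a) := by
    intro N
    have : ∀ a : I → ℕ, ∃ i, ∑ i, a i = N + 1 →
        pt N a i * ∑ j, h (pt N a) j ≤ h (pt N a) i := by
      intro a
      by_cases ha : ∑ i, a i = N + 1
      · exact (hlabel _ (hpt N a ha)).imp fun i hi _ => hi
      · exact ⟨Classical.arbitrary I, fun h => absurd h ha⟩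
    choose c hc using this
    exact ⟨c, hc⟩
  have hstep : ∀ N : ℕ, ∃ x ∈ stdSimplex ℝ I, ∀ i, ∃ y ∈ stdSimplex ℝ I,
      (∀ l, |y l - x l| ≤ (Fintype.card I : ℝ) / (N + 1 : ℕ)) ∧
      (y i - (Fintype.card I : ℝ) / (N + 1 : ℕ)) * ∑ j, h y j ≤ h y i := by
    intro N
    obtain ⟨c, hc⟩ := hcol N
    obtain ⟨x, hx, hxi⟩ := exists_grid_point_near_colors (N + 1) c
    have hN : (0 : ℝ) < (N + 1 : ℕ) := by positivity
    refine ⟨pt N x, hpt N x hx, fun i => ?_⟩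
    rcases hxi i with hsmall | ⟨y, hy, rfl, hxy⟩
    · refine ⟨pt N x, hpt N x hx, fun l => by simp only [sub_self, abs_zero]; positivity, ?_⟩
      refine le_trans (mul_nonpos_of_nonpos_of_nonneg ?_
        (Finset.sum_nonneg fun j _ => hnn _ (hpt N x hx) j)) (hnn _ (hpt N x hx) i)
      simp only [pt]
      rw [← sub_div]
      exact div_nonpos_of_nonpos_of_nonneg (sub_nonpos.2 (by exact_mod_cast hsmall)) hN.le
    · refine ⟨pt N y, hpt N y hy, fun l => ?_, ?_⟩
      · simp only [pt]
        rw [← sub_div, abs_div, abs_of_pos hN]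
        refine div_le_div_of_nonneg_right (abs_sub_le_iff.2 ⟨?_, ?_⟩) hN.le
        · rw [sub_le_iff_le_add']; exact_mod_cast (hxy l).1
        · rw [sub_le_iff_le_add']; exact_mod_cast (hxy l).2
      · refine le_trans (mul_le_mul_of_nonneg_right ?_
          (Finset.sum_nonneg fun j _ => hnn _ (hpt N y hy) j)) (hc y hy)
        exact sub_le_self _ (by positivity)
  choose x hx y hy hyx hyh using hstep
  obtain ⟨μ, hμ, φ, hφ, hlim⟩ := (isCompact_stdSimplex ℝ I).tendsto_subseq hx
  refine ⟨μ, hμ, fun i => ?_⟩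
  have hsmall : Tendsto (fun k => (Fintype.card I : ℝ) / (φ k + 1 : ℕ)) atTop (nhds 0) :=
    ((tendsto_const_div_atTop_nhds_zero_nat _).comp (tendsto_add_atTop_nat 1)).comp
      hφ.tendsto_atTop
  have hylim : Tendsto (fun k => y (φ k) i) atTop (nhds μ) := by
    rw [tendsto_pi_nhds] at hlim ⊢
    intro l
    have h0 : Tendsto (fun k => y (φ k) i l - x (φ k) l) atTop (nhds 0) :=
      squeeze_zero_norm (fun k => hyx (φ k) i l) hsmall
    simpa using h0.add (hlim l)
  have hyw : Tendsto (fun k => y (φ k) i) atTop (nhdsWithin μ (stdSimplex ℝ I)) :=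
    tendsto_nhdsWithin_iff.2 ⟨hylim, Eventually.of_forall fun k => hy _ _⟩
  have hhlim : ∀ j, Tendsto (fun k => h (y (φ k) i) j) atTop (nhds (h μ j)) := fun j =>
    (hcont j μ hμ).tendsto.comp hyw
  have hL := (((tendsto_pi_nhds.1 hylim i).sub hsmall).mul
    (tendsto_finsetSum Finset.univ fun j _ => hhlim j))
  rw [sub_zero] at hL
  exact le_of_tendsto_of_tendsto' hL (hhlim i) fun k => hyh (φ k) i

theorem pexp_of_ne_top {r : ℝ} {t : ℝ≥0∞} (ht : t ≠ ∞) :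
    pexp r t = ENNReal.ofReal (Real.exp (r * t.toReal)) := if_neg ht

theorem pexp_mono {r : ℝ} (hr : 0 ≤ r) : Monotone (pexp r) := by
  intro s t hst
  by_cases ht : t = ∞
  · simp [pexp, ht]
  · rw [pexp_of_ne_top ht, pexp_of_ne_top (ne_top_of_le_ne_top ht hst)]
    gcongr

theorem nexp_anti {r : ℝ} (hr : 0 ≤ r) : Antitone (nexp r) := by
  intro s t hst
  by_cases ht : t = ∞
  · simp [nexp, ht]
  · rw [nexp, nexp, if_neg ht, if_neg (ne_top_of_le_ne_top ht hst)]
    gcongr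

theorem nexp_ne_top (r : ℝ) (t : ℝ≥0∞) : nexp r t ≠ ∞ := by
  rw [nexp]; split_ifs <;> simp

theorem nexp_le_one {r : ℝ} (hr : 0 ≤ r) (t : ℝ≥0∞) : nexp r t ≤ 1 := by
  rw [nexp]
  split_ifs
  · simp
  · rw [ENNReal.ofReal_le_one, Real.exp_le_one_iff, neg_nonpos]
    positivity

theorem toReal_nexp_pos (r : ℝ) {t : ℝ≥0∞} (ht : t ≠ ∞) : 0 < (nexp r t).toReal := by
  rw [nexp, if_neg ht, ENNReal.toReal_ofReal (Real.exp_nonneg _)]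
  exact Real.exp_pos _

theorem pexp_mul_ofReal_le_iff {r a b : ℝ} (hr : 0 < r) (ha : 0 < a) (hab : a ≤ b) (t : ℝ≥0∞) :
    pexp r t * ENNReal.ofReal a ≤ ENNReal.ofReal b ↔
      t ≤ ENNReal.ofReal ((Real.log b - Real.log a) / r) := by
  by_cases ht : t = ∞
  · subst ht
    have : ENNReal.ofReal a ≠ 0 := (ENNReal.ofReal_pos.2 ha).ne'
    simp [pexp, ENNReal.top_mul this]
  · have hb : 0 < b := ha.trans_le hab
    rw [pexp_of_ne_top ht, ← ENNReal.ofReal_mul (Real.exp_nonneg _),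
      ENNReal.ofReal_le_ofReal_iff hb.le, ENNReal.le_ofReal_iff_toReal_le ht
        (div_nonneg (sub_nonneg.2 (Real.log_le_log ha hab)) hr.le), le_div_iff₀ hr,
      ← le_div_iff₀ ha, ← Real.le_log_iff_exp_le (div_pos hb ha),
      Real.log_div hb.ne' ha.ne', mul_comm]

/-- For a compact set of predictions, realizability passes to limits. -/
theorem exists_pexp_mul_le_one_of_tendsto {Ω : Type*} [Fintype Ω] {Λ : Set (Ω → ℝ≥0∞)}
    (hΛ : IsCompact Λ) {r : ℝ} (hr : 0 < r) {a : ℕ → Ω → ℝ} {a₀ : Ω → ℝ} {b : ℕ → ℝ}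
    (hab : ∀ k ω, a k ω ≤ b k) (ha : ∀ ω, Tendsto (fun k => a k ω) atTop (nhds (a₀ ω)))
    (hb : Tendsto b atTop (nhds 1))
    (h : ∀ k, ∃ γ ∈ Λ, ∀ ω, pexp r (γ ω) * ENNReal.ofReal (a k ω) ≤ ENNReal.ofReal (b k)) :
    ∃ γ ∈ Λ, ∀ ω, pexp r (γ ω) * ENNReal.ofReal (a₀ ω) ≤ 1 := by
  choose γ hγ hle using h
  obtain ⟨γ₀, hγ₀, φ, hφ, hlim⟩ := hΛ.tendsto_subseq hγ
  refine ⟨γ₀, hγ₀, fun ω => ?_⟩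
  rcases le_or_gt (a₀ ω) 0 with h0 | h0
  · simp [ENNReal.ofReal_of_nonpos h0]
  have h1 : a₀ ω ≤ 1 := le_of_tendsto_of_tendsto' (ha ω) hb fun k => hab k ω
  rw [← ENNReal.ofReal_one, pexp_mul_ofReal_le_iff hr h0 h1]
  have haφ := (ha ω).comp hφ.tendsto_atTop
  have hbφ := hb.comp hφ.tendsto_atTop
  have hrhs := ENNReal.tendsto_ofReal
    (((hbφ.log one_ne_zero).sub (haφ.log h0.ne')).div_const r)
  refine le_of_tendsto_of_tendsto (tendsto_pi_nhds.1 hlim ω) hrhs ?_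
  filter_upwards [haφ.eventually (lt_mem_nhds h0)] with k hk
  exact (pexp_mul_ofReal_le_iff hr hk (hab _ _) _).1 (hle (φ k) ω)

/-- A maximizer of `∏ x(ω)^π(ω)` (a log-optimal point) over a compact convex set satisfies the
Kuhn–Tucker conditions. -/
theorem exists_log_optimal {Ω : Type*} [Fintype Ω] {K : Set (Ω → ℝ)} (hK : IsCompact K)
    (hconv : Convex ℝ K) (hnn : ∀ x ∈ K, ∀ ω, 0 ≤ x ω) {e : Ω → ℝ} (he : e ∈ K)
    (hepos : ∀ ω, 0 < e ω) {π : Ω → ℝ} (hπ : ∀ ω, 0 < π ω) (hsum : ∑ ω, π ω = 1) :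
    ∃ u ∈ K, (∀ ω, 0 < u ω) ∧ ∀ x ∈ K, ∑ ω, π ω * (x ω / u ω) ≤ 1 := by
  have hc : Continuous fun x : Ω → ℝ => ∏ ω, x ω ^ π ω :=
    continuous_finsetProd _ fun ω _ => (continuous_apply ω).rpow_const fun _ => Or.inr (hπ ω).le
  obtain ⟨u, hu, hmax⟩ := hK.exists_isMaxOn ⟨e, he⟩ hc.continuousOn
  have hupos : ∀ ω, 0 < u ω := by
    intro ω
    refine lt_of_le_of_ne (hnn u hu ω) fun h0 => ?_
    have h1 : ∏ ω, e ω ^ π ω ≤ ∏ ω, u ω ^ π ω := hmax he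
    have h2 : u ω ^ π ω = 0 := by rw [← h0, Real.zero_rpow (hπ ω).ne']
    rw [Finset.prod_eq_zero (f := fun ω => u ω ^ π ω) (Finset.mem_univ ω) h2] at h1
    exact (Finset.prod_pos fun ω _ => Real.rpow_pos_of_pos (hepos ω) (π ω)).not_ge h1
  have hlog : ∀ z : Ω → ℝ, (∀ ω, 0 < z ω) →
      Real.log (∏ ω, z ω ^ π ω) = ∑ ω, π ω * Real.log (z ω) := by
    intro z hz
    rw [Real.log_prod fun ω _ => (Real.rpow_pos_of_pos (hz ω) _).ne']
    exact Finset.sum_congr rfl fun ω _ => Real.log_rpow (hz ω) _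
  refine ⟨u, hu, hupos, fun x hx => ?_⟩
  have hstep : ∀ t ∈ Set.Ioo (0 : ℝ) 1,
      ∑ ω, π ω * ((x ω - u ω) / (u ω + t * (x ω - u ω))) ≤ 0 := by
    rintro t ⟨ht0, ht1⟩
    have hz : ∀ ω, 0 < u ω + t * (x ω - u ω) := fun ω => by
      nlinarith [mul_pos (sub_pos.2 ht1) (hupos ω), mul_nonneg ht0.le (hnn x hx ω)]
    have hzK : (fun ω => u ω + t * (x ω - u ω)) ∈ K := by
      convert hconv hu hx (sub_nonneg.2 ht1.le) ht0.le (by ring) using 1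
      ext ω
      simp only [Pi.add_apply, Pi.smul_apply, smul_eq_mul]
      ring
    have h1 : ∏ ω, (u ω + t * (x ω - u ω)) ^ π ω ≤ ∏ ω, u ω ^ π ω := hmax hzK
    have h2 := Real.log_le_log
      (Finset.prod_pos fun ω _ => Real.rpow_pos_of_pos (hz ω) (π ω)) h1
    rw [hlog _ hz, hlog _ hupos, ← sub_nonpos, ← Finset.sum_sub_distrib] at h2
    have h3 : t * ∑ ω, π ω * ((x ω - u ω) / (u ω + t * (x ω - u ω))) ≤ 0 := by
      refine le_trans ?_ h2
      rw [Finset.mul_sum]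
      refine Finset.sum_le_sum fun ω _ => ?_
      have h4 := Real.log_le_sub_one_of_pos (div_pos (hupos ω) (hz ω))
      rw [Real.log_div (hupos ω).ne' (hz ω).ne'] at h4
      have h5 : t * ((x ω - u ω) / (u ω + t * (x ω - u ω))) =
          1 - u ω / (u ω + t * (x ω - u ω)) := by
        have := (hz ω).ne'
        field_simp
        ring
      rw [mul_left_comm, h5, ← mul_sub]
      exact mul_le_mul_of_nonneg_left (by linarith) (hπ ω).le
    exact nonpos_of_mul_nonpos_right h3 ht0
  have hlim : Tendsto (fun t : ℝ => ∑ ω, π ω * ((x ω - u ω) / (u ω + t * (x ω - u ω))))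
      (nhdsWithin 0 (Set.Ioi 0)) (nhds (∑ ω, π ω * ((x ω - u ω) / u ω))) := by
    refine tendsto_nhdsWithin_of_tendsto_nhds (tendsto_finsetSum _ fun ω _ => ?_)
    have : ContinuousAt (fun t : ℝ => π ω * ((x ω - u ω) / (u ω + t * (x ω - u ω)))) 0 :=
      continuousAt_const.mul (continuousAt_const.div (by fun_prop) (by simp [(hupos ω).ne']))
    simpa using this.tendsto
  have hle : ∑ ω, π ω * ((x ω - u ω) / u ω) ≤ 0 :=
    le_of_tendsto hlim (by
      filter_upwards [Ioo_mem_nhdsGT (zero_lt_one' ℝ)] with t ht using hstep t ht)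
  have heq : ∑ ω, π ω * ((x ω - u ω) / u ω) = ∑ ω, π ω * (x ω / u ω) - 1 := by
    rw [← hsum, ← Finset.sum_sub_distrib]
    refine Finset.sum_congr rfl fun ω _ => ?_
    have := (hupos ω).ne'
    field_simp
  linarith

/-- Log-optimal points depend continuously on the distribution. -/
theorem continuousOn_log_optimal {Ω : Type*} [Fintype Ω] {K : Set (Ω → ℝ)}
    (hK1 : ∀ x ∈ K, ∀ ω, x ω ≤ 1) {e : Ω → ℝ} (he : e ∈ K) (hepos : ∀ ω, 0 < e ω)
    {P : Set (Ω → ℝ)} (hPpos : ∀ π ∈ P, ∀ ω, 0 < π ω) (hPsum : ∀ π ∈ P, ∑ ω, π ω = 1)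
    {u : (Ω → ℝ) → Ω → ℝ} (hu : ∀ π ∈ P, u π ∈ K) (hupos : ∀ π ∈ P, ∀ ω, 0 < u π ω)
    (hopt : ∀ π ∈ P, ∀ x ∈ K, ∑ ω, π ω * (x ω / u π ω) ≤ 1) (ω : Ω) :
    ContinuousOn (fun π => u π ω) P := by
  intro p hp
  let B : (Ω → ℝ) → ℝ := fun p' => ∑ ω, |p ω - p' ω| * (1 / (p' ω * e ω))
  have hB : Tendsto B (nhdsWithin p P) (nhds 0) := by
    have hBp : ContinuousAt B p := by
      refine tendsto_finsetSum _ fun ω _ => ?_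
      exact (continuous_const.sub (continuous_apply ω)).abs.continuousAt.mul
        (continuousAt_const.div ((continuous_apply ω).mul continuous_const).continuousAt
          (mul_pos (hPpos p hp ω) (hepos ω)).ne')
    have h0 : B p = 0 := by simp [B]
    exact h0 ▸ hBp.tendsto.mono_left nhdsWithin_le_nhds
  have hmain : ∀ p' ∈ P, p ω * (u p' ω - u p ω) ^ 2 ≤ B p' := by
    intro p' hp'
    have h1 := hopt p hp _ (hu p' hp')
    have h2 := hopt p' hp' _ (hu p hp)
    have hterm : ∀ ω, p ω * (u p' ω - u p ω) ^ 2 ≤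
        p ω * (u p' ω / u p ω) + p' ω * (u p ω / u p' ω) - 2 * p ω +
          |p ω - p' ω| * (1 / (p' ω * e ω)) := by
      intro ω
      have hv := hupos p' hp' ω
      have hw := hupos p hp ω
      have hv1 := hK1 _ (hu p' hp') ω
      have hw1 := hK1 _ (hu p hp) ω
      have hsq : (u p' ω - u p ω) ^ 2 ≤ u p' ω / u p ω + u p ω / u p' ω - 2 := by
        have h3 : u p' ω / u p ω + u p ω / u p' ω - 2 =
            (u p' ω - u p ω) ^ 2 / (u p' ω * u p ω) := by
          field_simp
          ring
        rw [h3, le_div_iff₀ (mul_pos hv hw)]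
        exact mul_le_of_le_one_right (sq_nonneg _) (mul_le_one₀ hv1 hw.le hw1)
      have hbd : u p ω / u p' ω ≤ 1 / (p' ω * e ω) := by
        have hpe := mul_pos (hPpos p' hp' ω) (hepos ω)
        have h4 : p' ω * (e ω / u p' ω) ≤ 1 :=
          (Finset.single_le_sum (f := fun ω => p' ω * (e ω / u p' ω)) (fun ω _ =>
            mul_nonneg (hPpos p' hp' ω).le (div_nonneg (hepos ω).le (hupos p' hp' ω).le))
            (Finset.mem_univ ω)).trans (hopt p' hp' e he)
        rw [← mul_div_assoc, div_le_one hv] at h4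
        exact div_le_div₀ zero_le_one hw1 hpe h4
      have h5 := mul_le_mul_of_nonneg_left hsq (hPpos p hp ω).le
      have h6 : (p ω - p' ω) * (u p ω / u p' ω) ≤ |p ω - p' ω| * (1 / (p' ω * e ω)) :=
        mul_le_mul (le_abs_self _) hbd (div_nonneg hw.le hv.le) (abs_nonneg _)
      nlinarith
    have h7 := Finset.sum_le_sum fun ω (_ : ω ∈ Finset.univ) => hterm ω
    rw [Finset.sum_add_distrib, Finset.sum_sub_distrib, Finset.sum_add_distrib,
      ← Finset.mul_sum, hPsum p hp] at h7
    have h8 := Finset.single_le_sum (f := fun ω => p ω * (u p' ω - u p ω) ^ 2)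
      (fun ω _ => mul_nonneg (hPpos p hp ω).le (sq_nonneg _)) (Finset.mem_univ ω)
    simp only [B]
    linarith
  rw [ContinuousWithinAt, tendsto_iff_norm_sub_tendsto_zero]
  have hsqrt : Tendsto (fun p' => Real.sqrt (B p' / p ω)) (nhdsWithin p P) (nhds 0) := by
    simpa using (hB.div_const (p ω)).sqrt
  refine squeeze_zero' (Eventually.of_forall fun _ => norm_nonneg _) ?_ hsqrt
  filter_upwards [self_mem_nhdsWithin] with p' hp'
  rw [Real.norm_eq_abs]
  have hle := hmain p' hp'
  rw [mul_comm, ← le_div_iff₀ (hPpos p hp ω)] at hle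
  exact Real.abs_le_sqrt hle

/-- A continuous nonnegative `f` on the open simplex with `E_π f(π, ·) ≤ 1` can be made at most
`1 / (1 - ε)` in all coordinates simultaneously. -/
theorem exists_forall_le_of_expect_le_one {Ω : Type*} [Fintype Ω] [Nonempty Ω]
    {f : (Ω → ℝ) → Ω → ℝ}
    (hcont : ∀ ω, ContinuousOn (fun π => f π ω) {π ∈ stdSimplex ℝ Ω | ∀ ω, 0 < π ω})
    (hnn : ∀ π ω, 0 ≤ f π ω)
    (hexp : ∀ π ∈ {π ∈ stdSimplex ℝ Ω | ∀ ω, 0 < π ω}, ∑ ω, π ω * f π ω ≤ 1)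
    {ε : ℝ} (hε0 : 0 < ε) (hε1 : ε < 1) :
    ∃ π ∈ {π ∈ stdSimplex ℝ Ω | ∀ ω, 0 < π ω}, ∀ ω, f π ω ≤ 1 / (1 - ε) := by
  have hε : 0 < 1 - ε := sub_pos.2 hε1
  have hcard : (0 : ℝ) < Fintype.card Ω := by exact_mod_cast Fintype.card_pos
  let mix : (Ω → ℝ) → Ω → ℝ := fun μ ω => ε / Fintype.card Ω + (1 - ε) * μ ω
  have hmix : ∀ μ ∈ stdSimplex ℝ Ω, mix μ ∈ {π ∈ stdSimplex ℝ Ω | ∀ ω, 0 < π ω} := by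
    intro μ hμ
    have hpos : ∀ ω, 0 < mix μ ω := fun ω =>
      add_pos_of_pos_of_nonneg (div_pos hε0 hcard) (mul_nonneg hε.le (hμ.1 ω))
    refine ⟨⟨fun ω => (hpos ω).le, ?_⟩, hpos⟩
    simp only [mix, Finset.sum_add_distrib, Finset.sum_const, Finset.card_univ, nsmul_eq_mul,
      ← Finset.mul_sum, hμ.2]
    field_simp
    ring
  have hmixc : Continuous mix := by fun_prop
  let h : (Ω → ℝ) → Ω → ℝ := fun μ ω => max 0 (f (mix μ) ω - 1 / (1 - ε))
  obtain ⟨μ, hμ, hprop⟩ := exists_mem_stdSimplex_proportional (h := h)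
    (fun ω => continuousOn_const.sup
      (((hcont ω).comp hmixc.continuousOn hmix).sub continuousOn_const))
    (fun μ _ ω => le_max_left _ _)
  refine ⟨mix μ, hmix μ hμ, fun ω => ?_⟩
  have hbound : ∑ ω, μ ω * f (mix μ) ω ≤ 1 / (1 - ε) := by
    rw [le_div_iff₀ hε, mul_comm, Finset.mul_sum]
    refine le_trans (Finset.sum_le_sum fun ω _ => ?_) (hexp _ (hmix μ hμ))
    rw [← mul_assoc]
    refine mul_le_mul_of_nonneg_right ?_ (hnn _ ω)
    exact le_add_of_nonneg_left (div_pos hε0 hcard).le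
  set H := ∑ ω, h μ ω with hH
  have hH0 : 0 ≤ H := Finset.sum_nonneg fun ω _ => le_max_left _ _
  have hHz : H = 0 := by
    by_contra hne
    have hHpos : 0 < H := lt_of_le_of_ne hH0 (Ne.symm hne)
    have hterm : ∀ ω, μ ω * h μ ω = μ ω * f (mix μ) ω - μ ω * (1 / (1 - ε)) := by
      intro ω
      rcases (hμ.1 ω).eq_or_lt with h0 | h0
      · simp [← h0]
      · have hpos : 0 < h μ ω := by rw [hprop ω]; exact mul_pos h0 hHpos
        have : h μ ω = f (mix μ) ω - 1 / (1 - ε) :=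
          max_eq_right ((lt_max_iff.1 hpos).resolve_left (lt_irrefl _)).le
        rw [this, mul_sub]
    have hle : ∑ ω, μ ω * h μ ω ≤ 0 := by
      rw [Finset.sum_congr rfl fun ω _ => hterm ω, Finset.sum_sub_distrib, ← Finset.sum_mul, hμ.2]
      linarith
    obtain ⟨ω, -, hω⟩ : ∃ ω ∈ Finset.univ, 0 < μ ω :=
      Finset.exists_lt_of_sum_lt (by simp [hμ.2])
    have hnn' : ∀ ω ∈ Finset.univ, 0 ≤ μ ω * h μ ω := fun ω _ =>
      mul_nonneg (hμ.1 ω) (le_max_left _ _)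
    have h1 := (Finset.single_le_sum hnn' (Finset.mem_univ ω)).trans hle
    rw [hprop ω] at h1
    exact (mul_pos hω (mul_pos hω hHpos)).not_ge h1
  have h0 : h μ ω = 0 := by rw [hprop ω, hHz, mul_zero]
  have h1 : f (mix μ) ω - 1 / (1 - ε) ≤ h μ ω := le_max_right _ _
  linarith

/-- Real-valued form of realizability on finite mixtures: it extends to the closed convex hull of
the exponentiated predictions. -/
theorem exists_pexp_mul_le_one_of_mem_closure {Ω : Type*} [Fintype Ω] {Λ : Set (Ω → ℝ≥0∞)}
    (hcomp : IsCompact Λ) {r η : ℝ} (hr : 0 < r) (hη : 0 < η)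
    (hreal : ∀ k : ℕ, 0 < k → ∀ (gs : Fin k → Ω → ℝ≥0∞) (ρ : Fin k → ℝ),
      (∀ i, gs i ∈ superpred Λ) → (∀ i, 0 ≤ ρ i) → (∑ i, ρ i = 1) →
      ∃ γ ∈ superpred Λ, ∀ ω : Ω,
        pexp r (γ ω) * ∑ i, ENNReal.ofReal (ρ i) * nexp η (gs i ω) ≤ 1)
    {u : Ω → ℝ}
    (hu : u ∈ closure (convexHull ℝ ((fun γ ω => (nexp η (γ ω)).toReal) '' Λ))) :
    ∃ γ ∈ Λ, ∀ ω, pexp r (γ ω) * ENNReal.ofReal (u ω) ≤ 1 := by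
  obtain ⟨x, hx, hxu⟩ := mem_closure_iff_seq_limit.1 hu
  have hle : convexHull ℝ ((fun γ (ω : Ω) => (nexp η (γ ω)).toReal) '' Λ) ⊆ Set.Iic 1 := by
    refine convexHull_min ?_ (convex_Iic _)
    rintro _ ⟨γ, -, rfl⟩ ω
    exact ENNReal.toReal_le_of_le_ofReal zero_le_one (by simpa using nexp_le_one hη.le (γ ω))
  refine exists_pexp_mul_le_one_of_tendsto hcomp hr (a := x) (b := fun _ => 1)
    (fun k ω => hle (hx k) ω) (tendsto_pi_nhds.1 hxu) tendsto_const_nhds fun k => ?_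
  obtain ⟨ι, _, w, z, hw0, hw1, hz, hxk⟩ := mem_convexHull_iff_exists_fintype.1 (hx k)
  choose g hg hgz using hz
  have hne : 0 < Fintype.card ι := by
    rw [Fintype.card_pos_iff]
    by_contra hemp
    rw [not_nonempty_iff] at hemp
    simp at hw1
  let E := (Fintype.equivFin ι).symm
  obtain ⟨γ', ⟨γ, hγ, hγγ'⟩, hγle⟩ := hreal _ hne (fun i => g (E i)) (fun i => w (E i))
    (fun i => ⟨g (E i), hg _, fun _ => le_rfl⟩) (fun i => hw0 _) (by rw [E.sum_comp, hw1])
  refine ⟨γ, hγ, fun ω => ?_⟩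
  rw [ENNReal.ofReal_one]
  refine le_trans (mul_le_mul' (pexp_mono hr.le (hγγ' ω)) (le_of_eq ?_)) (hγle ω)
  rw [E.sum_comp (fun i => ENNReal.ofReal (w i) * nexp η (g i ω)), ← hxk, Finset.sum_apply,
    ENNReal.ofReal_sum_of_nonneg]
  · refine Finset.sum_congr rfl fun i _ => ?_
    rw [← hgz i, Pi.smul_apply, smul_eq_mul, ENNReal.ofReal_mul (hw0 i),
      ENNReal.ofReal_toReal (nexp_ne_top _ _)]
  · intro i _
    rw [← hgz i, Pi.smul_apply, smul_eq_mul]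
    exact mul_nonneg (hw0 i) ENNReal.toReal_nonneg

/-- Realizability yields forecast-continuous supermartingales, by playing log-optimal points. -/
theorem supermartingale_of_realizable {Ω : Type*} [Fintype Ω] {Λ : Set (Ω → ℝ≥0∞)}
    (hcomp : IsCompact Λ) (hfin : ∃ g ∈ Λ, ∀ ω, g ω ≠ ∞) {r η : ℝ} (hr : 0 < r) (hη : 0 < η)
    (hreal : ∀ k : ℕ, 0 < k → ∀ (gs : Fin k → Ω → ℝ≥0∞) (ρ : Fin k → ℝ),
      (∀ i, gs i ∈ superpred Λ) → (∀ i, 0 ≤ ρ i) → (∑ i, ρ i = 1) →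
      ∃ γ ∈ superpred Λ, ∀ ω : Ω,
        pexp r (γ ω) * ∑ i, ENNReal.ofReal (ρ i) * nexp η (gs i ω) ≤ 1) :
    ∃ lam : (Ω → ℝ) → Ω → ℝ≥0∞,
      (∀ π ∈ {π ∈ stdSimplex ℝ Ω | ∀ ω, 0 < π ω}, lam π ∈ superpred Λ) ∧
      ∀ g ∈ superpred Λ,
        (∀ ω : Ω, ContinuousOn (fun π => pexp r (lam π ω) * nexp η (g ω))
          {π ∈ stdSimplex ℝ Ω | ∀ ω, 0 < π ω}) ∧
        (∀ π ∈ {π ∈ stdSimplex ℝ Ω | ∀ ω, 0 < π ω},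
          expect π (fun ω => pexp r (lam π ω) * nexp η (g ω)) ≤ 1) := by
  set P := {π ∈ stdSimplex ℝ Ω | ∀ ω, 0 < π ω} with hP
  set K := closure (convexHull ℝ ((fun γ (ω : Ω) => (nexp η (γ ω)).toReal) '' Λ)) with hKdef
  have hmem : ∀ γ ∈ Λ, (fun ω => (nexp η (γ ω)).toReal) ∈ K := fun γ hγ =>
    subset_closure (subset_convexHull ℝ _ ⟨γ, hγ, rfl⟩)
  have hK01 : K ⊆ Set.Icc 0 1 := by
    refine closure_minimal (convexHull_min ?_ (convex_Icc _ _)) isClosed_Icc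
    rintro _ ⟨γ, -, rfl⟩
    exact ⟨fun ω => ENNReal.toReal_nonneg, fun ω =>
      ENNReal.toReal_le_of_le_ofReal zero_le_one (by simpa using nexp_le_one hη.le (γ ω))⟩
  have hKc : IsCompact K := isCompact_Icc.of_isClosed_subset isClosed_closure hK01
  obtain ⟨g₀, hg₀, hg₀fin⟩ := hfin
  have hepos : ∀ ω, 0 < (nexp η (g₀ ω)).toReal := fun ω => toReal_nexp_pos η (hg₀fin ω)
  have hex : ∀ π, ∃ u : Ω → ℝ, π ∈ P → u ∈ K ∧ (∀ ω, 0 < u ω) ∧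
      ∀ x ∈ K, ∑ ω, π ω * (x ω / u ω) ≤ 1 := by
    intro π
    by_cases hπ : π ∈ P
    · obtain ⟨u, hu⟩ := exists_log_optimal hKc (convex_convexHull ℝ _).closure
        (fun x hx => (hK01 hx).1) (hmem g₀ hg₀) hepos hπ.2 hπ.1.2
      exact ⟨u, fun _ => hu⟩
    · exact ⟨0, fun h => absurd h hπ⟩
  choose u hu using hex
  have hu1 : ∀ π ∈ P, ∀ ω, u π ω ≤ 1 := fun π hπ => (hK01 (hu π hπ).1).2
  have hcont := continuousOn_log_optimal (P := P) (fun x hx => (hK01 hx).2) (hmem g₀ hg₀) hepos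
    (fun π hπ => hπ.2) (fun π hπ => hπ.1.2) (fun π hπ => (hu π hπ).1)
    (fun π hπ => (hu π hπ).2.1) (fun π hπ => (hu π hπ).2.2)
  let lam : (Ω → ℝ) → Ω → ℝ≥0∞ := fun π ω =>
    ENNReal.ofReal ((Real.log 1 - Real.log (u π ω)) / r)
  have hlam : ∀ π ∈ P, ∀ ω, pexp r (lam π ω) = ENNReal.ofReal (u π ω)⁻¹ := by
    intro π hπ ω
    have hpos := (hu π hπ).2.1 ω
    have hnn : 0 ≤ (Real.log 1 - Real.log (u π ω)) / r :=
      div_nonneg (sub_nonneg.2 (Real.log_le_log hpos (hu1 π hπ ω))) hr.le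
    rw [pexp_of_ne_top ENNReal.ofReal_ne_top, ENNReal.toReal_ofReal hnn, mul_div_cancel₀ _ hr.ne',
      Real.log_one, zero_sub, Real.exp_neg, Real.exp_log hpos]
  refine ⟨lam, fun π hπ => ?_, fun g hg => ⟨fun ω => ?_, fun π hπ => ?_⟩⟩
  · obtain ⟨γ, hγ, hle⟩ := exists_pexp_mul_le_one_of_mem_closure hcomp hr hη hreal (hu π hπ).1
    refine ⟨γ, hγ, fun ω => ?_⟩
    rw [← pexp_mul_ofReal_le_iff hr ((hu π hπ).2.1 ω) (hu1 π hπ ω), ENNReal.ofReal_one]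
    exact hle ω
  · refine ContinuousOn.congr (f := fun π => ENNReal.ofReal (u π ω)⁻¹ * nexp η (g ω)) ?_
      fun π hπ => by simp only [hlam π hπ ω]
    exact (ENNReal.continuous_mul_const (nexp_ne_top _ _)).comp_continuousOn
      (ENNReal.continuous_ofReal.comp_continuousOn
        ((hcont ω).inv₀ fun π hπ => ((hu π hπ).2.1 ω).ne'))
  · obtain ⟨γ, hγ, hγg⟩ := hg
    have hopt := (hu π hπ).2.2 _ (hmem γ hγ)
    rw [← ENNReal.ofReal_le_one, ENNReal.ofReal_sum_of_nonneg fun ω _ =>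
      mul_nonneg (hπ.2 ω).le (div_nonneg ENNReal.toReal_nonneg ((hu π hπ).2.1 ω).le)] at hopt
    refine le_trans (Finset.sum_le_sum fun ω _ => ?_) hopt
    beta_reduce
    rw [ENNReal.ofReal_mul (hπ.2 ω).le, hlam π hπ ω, div_eq_inv_mul,
      ENNReal.ofReal_mul (inv_nonneg.2 ((hu π hπ).2.1 ω).le),
      ENNReal.ofReal_toReal (nexp_ne_top _ _)]
    gcongr
    exact nexp_anti hη.le (hγg ω)

/-- Forecast-continuous supermartingales yield realizability. -/
theorem realizable_of_supermartingale {Ω : Type*} [Fintype Ω] [Nonempty Ω] {Λ : Set (Ω → ℝ≥0∞)}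
    (hcomp : IsCompact Λ) {r η : ℝ} (hr : 0 < r) (hη : 0 < η) {lam : (Ω → ℝ) → Ω → ℝ≥0∞}
    (hlam : ∀ π ∈ {π ∈ stdSimplex ℝ Ω | ∀ ω, 0 < π ω}, lam π ∈ superpred Λ)
    (hq : ∀ g ∈ superpred Λ,
        (∀ ω : Ω, ContinuousOn (fun π => pexp r (lam π ω) * nexp η (g ω))
          {π ∈ stdSimplex ℝ Ω | ∀ ω, 0 < π ω}) ∧
        (∀ π ∈ {π ∈ stdSimplex ℝ Ω | ∀ ω, 0 < π ω},
          expect π (fun ω => pexp r (lam π ω) * nexp η (g ω)) ≤ 1))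
    {k : ℕ} {gs : Fin k → Ω → ℝ≥0∞} {ρ : Fin k → ℝ} (hgs : ∀ i, gs i ∈ superpred Λ)
    (hρ : ∀ i, 0 ≤ ρ i) (hρ1 : ∑ i, ρ i = 1) :
    ∃ γ ∈ superpred Λ, ∀ ω : Ω,
      pexp r (γ ω) * ∑ i, ENNReal.ofReal (ρ i) * nexp η (gs i ω) ≤ 1 := by
  set P := {π ∈ stdSimplex ℝ Ω | ∀ ω, 0 < π ω} with hP
  set A : Ω → ℝ≥0∞ := fun ω => ∑ i, ENNReal.ofReal (ρ i) * nexp η (gs i ω) with hA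
  have hρ1' : ∑ i, ENNReal.ofReal (ρ i) = 1 := by
    rw [← ENNReal.ofReal_sum_of_nonneg fun i _ => hρ i, hρ1, ENNReal.ofReal_one]
  have hA1 : ∀ ω, A ω ≤ 1 := fun ω => by
    rw [← hρ1']
    exact Finset.sum_le_sum fun i _ => mul_le_of_le_one_right' (nexp_le_one hη.le _)
  have hAtop : ∀ ω, A ω ≠ ∞ := fun ω => ne_top_of_le_ne_top ENNReal.one_ne_top (hA1 ω)
  let F : (Ω → ℝ) → Ω → ℝ≥0∞ := fun π ω => pexp r (lam π ω) * A ω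
  have hFsum : ∀ π ω, F π ω =
      ∑ i, ENNReal.ofReal (ρ i) * (pexp r (lam π ω) * nexp η (gs i ω)) := by
    intro π ω
    simp only [F, hA, Finset.mul_sum, mul_left_comm]
  have hFexp : ∀ π ∈ P, ∑ ω, ENNReal.ofReal (π ω) * F π ω ≤ 1 := by
    intro π hπ
    have h1 : ∑ ω, ENNReal.ofReal (π ω) * F π ω =
        ∑ i, ENNReal.ofReal (ρ i) * expect π (fun ω => pexp r (lam π ω) * nexp η (gs i ω)) := by
      simp only [hFsum, expect, Finset.mul_sum]
      rw [Finset.sum_comm]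
      exact Finset.sum_congr rfl fun i _ => Finset.sum_congr rfl fun ω _ => mul_left_comm _ _ _
    rw [h1, ← hρ1']
    exact Finset.sum_le_sum fun i _ => mul_le_of_le_one_right' ((hq _ (hgs i)).2 π hπ)
  have hFtop : ∀ π ∈ P, ∀ ω, F π ω ≠ ∞ := by
    intro π hπ ω h
    have h1 := (Finset.single_le_sum (f := fun ω => ENNReal.ofReal (π ω) * F π ω)
      (fun _ _ => zero_le) (Finset.mem_univ ω)).trans (hFexp π hπ)
    simp only [h, ENNReal.mul_top (ENNReal.ofReal_pos.2 (hπ.2 ω)).ne'] at h1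
    exact absurd h1 (by simp)
  have hFcont : ∀ ω, ContinuousOn (fun π => (F π ω).toReal) P := by
    intro ω π hπ
    refine (ENNReal.tendsto_toReal (hFtop π hπ ω)).comp ?_
    simp only [hFsum]
    exact tendsto_finsetSum _ fun i _ =>
      ((ENNReal.continuous_const_mul ENNReal.ofReal_ne_top).tendsto _).comp
        ((hq _ (hgs i)).1 ω π hπ)
  have hFexp' : ∀ π ∈ P, ∑ ω, π ω * (F π ω).toReal ≤ 1 := by
    intro π hπ
    rw [← ENNReal.ofReal_le_one, ENNReal.ofReal_sum_of_nonneg fun ω _ =>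
      mul_nonneg (hπ.2 ω).le ENNReal.toReal_nonneg]
    refine le_trans (le_of_eq (Finset.sum_congr rfl fun ω _ => ?_)) (hFexp π hπ)
    rw [ENNReal.ofReal_mul (hπ.2 ω).le, ENNReal.ofReal_toReal (hFtop π hπ ω)]
  let ε : ℕ → ℝ := fun n => 1 / ((n : ℝ) + 2)
  have hε0 : ∀ n, 0 < ε n := fun n => by positivity
  have hε1 : ∀ n, ε n < 1 := fun n => by
    rw [div_lt_one (by positivity)]
    linarith [n.cast_nonneg (α := ℝ)]
  have hεlim : Tendsto ε atTop (nhds 0) := by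
    have := (tendsto_one_div_add_atTop_nhds_zero_nat (𝕜 := ℝ)).comp (tendsto_add_atTop_nat 1)
    refine this.congr fun n => ?_
    simp only [Function.comp, ε]
    push_cast
    ring
  have hblim : Tendsto (fun n => 1 / (1 - ε n)) atTop (nhds 1) := by
    simpa using ((tendsto_const_nhds (x := (1 : ℝ))).sub hεlim).inv₀ (by norm_num)
  have happrox : ∀ n, ∃ γ ∈ Λ, ∀ ω,
      pexp r (γ ω) * ENNReal.ofReal (A ω).toReal ≤ ENNReal.ofReal (1 / (1 - ε n)) := by
    intro n
    obtain ⟨π, hπ, hle⟩ := exists_forall_le_of_expect_le_one hFcont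
      (fun _ _ => ENNReal.toReal_nonneg) hFexp' (hε0 n) (hε1 n)
    obtain ⟨γ, hγ, hγlam⟩ := hlam π hπ
    refine ⟨γ, hγ, fun ω => ?_⟩
    rw [ENNReal.ofReal_toReal (hAtop ω)]
    refine le_trans (mul_le_mul_left (pexp_mono hr.le (hγlam ω)) _) ?_
    exact (ENNReal.le_ofReal_iff_toReal_le (hFtop π hπ ω)
      (div_nonneg zero_le_one (sub_nonneg.2 (hε1 n).le))).2 (hle ω)
  obtain ⟨γ, hγ, hle⟩ := exists_pexp_mul_le_one_of_tendsto hcomp hr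
    (a := fun _ ω => (A ω).toReal) (a₀ := fun ω => (A ω).toReal)
    (fun n ω => (ENNReal.toReal_le_of_le_ofReal zero_le_one (by simpa using hA1 ω)).trans
      ((one_le_div (sub_pos.2 (hε1 n))).2 (sub_le_self _ (hε0 n).le)))
    (fun ω => tendsto_const_nhds) hblim happrox
  refine ⟨γ, ⟨γ, hγ, fun _ => le_rfl⟩, fun ω => ?_⟩
  have h := hle ω
  rwa [ENNReal.ofReal_toReal (hAtop ω)] at h

/-- Theorem 6 of the paper: a criterion for `(c,η)`-realizability of the
Aggregating Algorithm in terms of supermartingales on `𝒫°(Ω)`. -/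
theorem aa_realizability_criterion
    {Ω : Type*} [Fintype Ω] [Nonempty Ω]
    (Λ : Set (Ω → ℝ≥0∞))
    (hcomp : IsCompact Λ) (hfin : ∃ g ∈ Λ, ∀ ω, g ω ≠ ∞)
    (c η : ℝ) (hc : 1 ≤ c) (hη : 0 < η) :
    -- (i) the AA is (c,η)-realizable
    (∀ k : ℕ, 0 < k → ∀ (gs : Fin k → Ω → ℝ≥0∞) (ρ : Fin k → ℝ),
      (∀ i, gs i ∈ superpred Λ) → (∀ i, 0 ≤ ρ i) → (∑ i, ρ i = 1) →
      ∃ γ ∈ superpred Λ, ∀ ω : Ω,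
        pexp (η / c) (γ ω) * ∑ i, ENNReal.ofReal (ρ i) * nexp η (gs i ω) ≤ 1)
    ↔
    -- (ii) some `λ : 𝒫°(Ω) → Σ_Λ` makes the `q_g` forecast-continuous
    -- supermartingales on `𝒫°(Ω)`
    (∃ lam : (Ω → ℝ) → Ω → ℝ≥0∞,
      (∀ π ∈ {π ∈ stdSimplex ℝ Ω | ∀ ω, 0 < π ω}, lam π ∈ superpred Λ) ∧
      ∀ g ∈ superpred Λ,
        (∀ ω : Ω, ContinuousOn (fun π => pexp (η / c) (lam π ω) * nexp η (g ω))
          {π ∈ stdSimplex ℝ Ω | ∀ ω, 0 < π ω}) ∧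
        (∀ π ∈ {π ∈ stdSimplex ℝ Ω | ∀ ω, 0 < π ω},
          expect π (fun ω => pexp (η / c) (lam π ω) * nexp η (g ω)) ≤ 1)) := by
  have hr : 0 < η / c := div_pos hη (zero_lt_one.trans_le hc)
  constructor
  · exact supermartingale_of_realizable hcomp hfin hr hη
  · rintro ⟨lam, hlam, hq⟩ k - gs ρ hgs hρ hρ1
    exact realizable_of_supermartingale hcomp hr hη hlam hq hgs hρ hρ1
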